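/- For every z in the upper half-plane ℍ, Φ₂₀(x(z)) = η(z)⁸·Δ(z)·E₄(z), where x(z) = (x₁(z),...,x₆(z)) is the vector of eta-multiplied theta constants of order 13, Δ(z) = η(z)²⁴ is the modular discriminant and E₄ is the normalized Eisenstein series of weight 4. -/

import Mathlib

noncomputable section

open Complex

def ζ : ℂ := Complex.exp (2 * Real.pi * Complex.I / 13)

def AA0 (v : Fin 6 → ℂ) : ℂ := v 0 * v 3 + v 1 * v 4 + v 2 * v 5
def AA1 (v : Fin 6 → ℂ) : ℂ := (v 0) ^ 2 - 2 * v 2 * v 3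
def AA2 (v : Fin 6 → ℂ) : ℂ := -(v 4) ^ 2 - 2 * v 1 * v 3
def AA3 (v : Fin 6 → ℂ) : ℂ := (v 1) ^ 2 - 2 * v 0 * v 4
def AA4 (v : Fin 6 → ℂ) : ℂ := (v 2) ^ 2 - 2 * v 1 * v 5
def AA5 (v : Fin 6 → ℂ) : ℂ := -(v 3) ^ 2 - 2 * v 0 * v 5
def AA6 (v : Fin 6 → ℂ) : ℂ := -(v 5) ^ 2 - 2 * v 2 * v 4

def DD0 (v : Fin 6 → ℂ) : ℂ := v 0 * v 1 * v 2
def DD1 (v : Fin 6 → ℂ) : ℂ := 2 * v 1 * (v 2) ^ 2 + (v 1) ^ 2 * v 5 - (v 3) ^ 2 * v 4 + v 0 * v 4 * v 5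
def DD2 (v : Fin 6 → ℂ) : ℂ := -(v 5) ^ 3 + (v 1) ^ 2 * v 3 - 2 * v 1 * (v 4) ^ 2 + v 0 * v 3 * v 4 + 3 * v 2 * v 4 * v 5
def DD3 (v : Fin 6 → ℂ) : ℂ := 2 * v 0 * (v 1) ^ 2 + (v 0) ^ 2 * v 4 - v 3 * (v 5) ^ 2 + v 2 * v 3 * v 4
def DD4 (v : Fin 6 → ℂ) : ℂ := -(v 1) ^ 2 * v 2 + v 0 * (v 5) ^ 2 - 2 * (v 3) ^ 2 * v 5 - v 0 * v 2 * v 4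
def DD5 (v : Fin 6 → ℂ) : ℂ := -(v 3) ^ 3 + (v 2) ^ 2 * v 4 - 2 * v 2 * (v 5) ^ 2 + v 1 * v 4 * v 5 + 3 * v 0 * v 3 * v 5
def DD6 (v : Fin 6 → ℂ) : ℂ := -(v 4) ^ 3 + (v 0) ^ 2 * v 5 - 2 * v 0 * (v 3) ^ 2 + v 2 * v 3 * v 5 + 3 * v 1 * v 3 * v 4
def DD7 (v : Fin 6 → ℂ) : ℂ := -(v 1) ^ 3 + v 2 * (v 3) ^ 2 - v 0 * v 2 * v 5 - 3 * v 0 * v 1 * v 4 + 2 * (v 0) ^ 2 * v 3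
def DD8 (v : Fin 6 → ℂ) : ℂ := -(v 0) ^ 3 + v 1 * (v 5) ^ 2 - v 1 * v 2 * v 4 - 3 * v 0 * v 2 * v 3 + 2 * (v 2) ^ 2 * v 5
def DD9 (v : Fin 6 → ℂ) : ℂ := 2 * (v 0) ^ 2 * v 2 + (v 2) ^ 2 * v 3 - (v 4) ^ 2 * v 5 + v 1 * v 3 * v 5
def DD10 (v : Fin 6 → ℂ) : ℂ := -(v 0) * (v 2) ^ 2 + v 1 * (v 3) ^ 2 - 2 * v 3 * (v 4) ^ 2 - v 0 * v 1 * v 5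
def DD11 (v : Fin 6 → ℂ) : ℂ := -(v 2) ^ 3 + v 0 * (v 4) ^ 2 - v 0 * v 1 * v 3 - 3 * v 1 * v 2 * v 5 + 2 * (v 1) ^ 2 * v 4
def DD12 (v : Fin 6 → ℂ) : ℂ := -(v 0) ^ 2 * v 1 + v 2 * (v 4) ^ 2 - 2 * v 4 * (v 5) ^ 2 - v 1 * v 2 * v 3
def DDinf (v : Fin 6 → ℂ) : ℂ := v 3 * v 4 * v 5

def GG0 (v : Fin 6 → ℂ) : ℂ := (DD0 v) ^ 2 + (DDinf v) ^ 2
def GG1 (v : Fin 6 → ℂ) : ℂ := -(DD7 v) ^ 2 + 2 * DD0 v * DD1 v + 10 * DDinf v * DD1 v + 2 * DD2 v * DD12 v - 2 * DD3 v * DD11 v - 4 * DD4 v * DD10 v - 2 * DD9 v * DD5 v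
def GG2 (v : Fin 6 → ℂ) : ℂ := -2 * (DD1 v) ^ 2 - 4 * DD0 v * DD2 v + 6 * DDinf v * DD2 v - 2 * DD4 v * DD11 v + 2 * DD5 v * DD10 v - 2 * DD6 v * DD9 v - 2 * DD7 v * DD8 v
def GG3 (v : Fin 6 → ℂ) : ℂ := -(DD8 v) ^ 2 + 2 * DD0 v * DD3 v + 10 * DDinf v * DD3 v + 2 * DD6 v * DD10 v - 2 * DD9 v * DD7 v - 4 * DD12 v * DD4 v - 2 * DD1 v * DD2 v
def GG4 (v : Fin 6 → ℂ) : ℂ := -(DD2 v) ^ 2 + 10 * DD0 v * DD4 v - 2 * DDinf v * DD4 v + 2 * DD5 v * DD12 v - 2 * DD9 v * DD8 v - 4 * DD1 v * DD3 v - 2 * DD10 v * DD7 v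
def GG5 (v : Fin 6 → ℂ) : ℂ := -2 * (DD9 v) ^ 2 - 4 * DD0 v * DD5 v + 6 * DDinf v * DD5 v - 2 * DD10 v * DD8 v + 2 * DD6 v * DD12 v - 2 * DD2 v * DD3 v - 2 * DD11 v * DD7 v
def GG6 (v : Fin 6 → ℂ) : ℂ := -2 * (DD3 v) ^ 2 - 4 * DD0 v * DD6 v + 6 * DDinf v * DD6 v - 2 * DD12 v * DD7 v + 2 * DD2 v * DD4 v - 2 * DD5 v * DD1 v - 2 * DD8 v * DD11 v
def GG7 (v : Fin 6 → ℂ) : ℂ := -2 * (DD10 v) ^ 2 + 6 * DD0 v * DD7 v + 4 * DDinf v * DD7 v - 2 * DD1 v * DD6 v - 2 * DD2 v * DD5 v - 2 * DD8 v * DD12 v - 2 * DD9 v * DD11 v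
def GG8 (v : Fin 6 → ℂ) : ℂ := -2 * (DD4 v) ^ 2 + 6 * DD0 v * DD8 v + 4 * DDinf v * DD8 v - 2 * DD3 v * DD5 v - 2 * DD6 v * DD2 v - 2 * DD11 v * DD10 v - 2 * DD1 v * DD7 v
def GG9 (v : Fin 6 → ℂ) : ℂ := -(DD11 v) ^ 2 + 2 * DD0 v * DD9 v + 10 * DDinf v * DD9 v + 2 * DD5 v * DD4 v - 2 * DD1 v * DD8 v - 4 * DD10 v * DD12 v - 2 * DD3 v * DD6 v
def GG10 (v : Fin 6 → ℂ) : ℂ := -(DD5 v) ^ 2 + 10 * DD0 v * DD10 v - 2 * DDinf v * DD10 v + 2 * DD6 v * DD4 v - 2 * DD3 v * DD7 v - 4 * DD9 v * DD1 v - 2 * DD12 v * DD11 v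
def GG11 (v : Fin 6 → ℂ) : ℂ := -2 * (DD12 v) ^ 2 + 6 * DD0 v * DD11 v + 4 * DDinf v * DD11 v - 2 * DD9 v * DD2 v - 2 * DD5 v * DD6 v - 2 * DD7 v * DD4 v - 2 * DD3 v * DD8 v
def GG12 (v : Fin 6 → ℂ) : ℂ := -(DD6 v) ^ 2 + 10 * DD0 v * DD12 v - 2 * DDinf v * DD12 v + 2 * DD2 v * DD10 v - 2 * DD1 v * DD11 v - 4 * DD3 v * DD9 v - 2 * DD4 v * DD8 v

def wInf (v : Fin 6 → ℂ) : ℂ := 13 * (AA0 v) ^ 2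
def wF (ν : ℕ) (v : Fin 6 → ℂ) : ℂ :=
  (AA0 v + ζ ^ ν * AA1 v + ζ ^ (4 * ν) * AA2 v + ζ ^ (9 * ν) * AA3 v + ζ ^ (3 * ν) * AA4 v
    + ζ ^ (12 * ν) * AA5 v + ζ ^ (10 * ν) * AA6 v) ^ 2
def dInf (v : Fin 6 → ℂ) : ℂ := 13 ^ 2 * GG0 v
def dF (ν : ℕ) (v : Fin 6 → ℂ) : ℂ :=
  -13 * GG0 v + ζ ^ ν * GG1 v + ζ ^ (2 * ν) * GG2 v + ζ ^ (3 * ν) * GG3 v + ζ ^ (4 * ν) * GG4 v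
    + ζ ^ (5 * ν) * GG5 v + ζ ^ (6 * ν) * GG6 v + ζ ^ (7 * ν) * GG7 v + ζ ^ (8 * ν) * GG8 v
    + ζ ^ (9 * ν) * GG9 v + ζ ^ (10 * ν) * GG10 v + ζ ^ (11 * ν) * GG11 v + ζ ^ (12 * ν) * GG12 v

def Phi12 (v : Fin 6 → ℂ) : ℂ :=
  -(1 / (13 * 52) : ℂ) * ((∑ ν ∈ Finset.range 13, (dF ν v) ^ 2) + (dInf v) ^ 2)
def Phi18 (v : Fin 6 → ℂ) : ℂ :=
  (1 / (13 * 6) : ℂ) * ((∑ ν ∈ Finset.range 13, (dF ν v) ^ 3) + (dInf v) ^ 3)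
def Phi30 (v : Fin 6 → ℂ) : ℂ :=
  -(1 / (13 * 1315) : ℂ) * ((∑ ν ∈ Finset.range 13, (dF ν v) ^ 5) + (dInf v) ^ 5)
def Phi42 (v : Fin 6 → ℂ) : ℂ :=
  (1 / (13 * 226842) : ℂ) * ((∑ ν ∈ Finset.range 13, (dF ν v) ^ 7) + (dInf v) ^ 7)

def Phi20 (v : Fin 6 → ℂ) : ℂ :=
  (1 / (13 * 25) : ℂ) * ((∑ ν ∈ Finset.range 13, (wF ν v) ^ 5) + (wInf v) ^ 5)
def Phi32 (v : Fin 6 → ℂ) : ℂ :=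
  -(1 / (13 * 1840) : ℂ) * ((∑ ν ∈ Finset.range 13, (wF ν v) ^ 8) + (wInf v) ^ 8)
def Phi44 (v : Fin 6 → ℂ) : ℂ :=
  (1 / (13 * 146905) : ℂ) * ((∑ ν ∈ Finset.range 13, (wF ν v) ^ 11) + (wInf v) ^ 11)

def th13 (c : ℚ) (k : ℤ) (z : ℂ) : ℂ :=
  Complex.exp (2 * Real.pi * Complex.I * (c : ℂ) * z) *
    ∑' n : ℤ, (-1 : ℂ) ^ n *
      Complex.exp (2 * Real.pi * Complex.I * (((13 * n ^ 2 + k * n : ℤ) : ℂ) / 2) * z)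

def ta : Fin 6 → ℂ → ℂ :=
  ![th13 (121 / 104) 11, th13 (49 / 104) 7, th13 (25 / 104) 5,
    fun z => -th13 (9 / 104) 3 z, th13 (81 / 104) 9, th13 (1 / 104) 1]

def AV (z : ℂ) : Fin 6 → ℂ := fun i => ta i z

def etaF (z : ℂ) : ℂ :=
  Complex.exp (2 * Real.pi * Complex.I * z / 24) *
    ∏' n : ℕ, (1 - Complex.exp (2 * Real.pi * Complex.I * z) ^ (n + 1))

def xV (z : ℂ) : Fin 6 → ℂ := fun i => etaF z * ta i z

def Δfun (z : ℂ) : ℂ := (etaF z) ^ 24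

def Eis (k : ℕ) (z : ℂ) : ℂ :=
  (1 / 2 : ℂ) * ∑' p : {p : ℤ × ℤ // Int.gcd p.1 p.2 = 1},
    1 / ((p.val.1 : ℂ) * z + (p.val.2 : ℂ)) ^ k


/-- The action on theta constants of `z ↦ -1 / z`, up to a scalar, for a 13th root of unity `x`. -/
def sMat (x : ℂ) (v : Fin 6 → ℂ) : Fin 6 → ℂ :=
  ![-(x - x ^ 12) * v 0 - (x ^ 3 - x ^ 10) * v 1 + (x ^ 4 - x ^ 9) * v 2
      + (x ^ 5 - x ^ 8) * v 3 + (x ^ 2 - x ^ 11) * v 4 + (x ^ 6 - x ^ 7) * v 5,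
    -(x ^ 3 - x ^ 10) * v 0 + (x ^ 4 - x ^ 9) * v 1 - (x - x ^ 12) * v 2
      + (x ^ 2 - x ^ 11) * v 3 + (x ^ 6 - x ^ 7) * v 4 + (x ^ 5 - x ^ 8) * v 5,
    (x ^ 4 - x ^ 9) * v 0 - (x - x ^ 12) * v 1 - (x ^ 3 - x ^ 10) * v 2
      + (x ^ 6 - x ^ 7) * v 3 + (x ^ 5 - x ^ 8) * v 4 + (x ^ 2 - x ^ 11) * v 5,
    (x ^ 5 - x ^ 8) * v 0 + (x ^ 2 - x ^ 11) * v 1 + (x ^ 6 - x ^ 7) * v 2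
      + (x - x ^ 12) * v 3 + (x ^ 3 - x ^ 10) * v 4 - (x ^ 4 - x ^ 9) * v 5,
    (x ^ 2 - x ^ 11) * v 0 + (x ^ 6 - x ^ 7) * v 1 + (x ^ 5 - x ^ 8) * v 2
      + (x ^ 3 - x ^ 10) * v 3 - (x ^ 4 - x ^ 9) * v 4 + (x - x ^ 12) * v 5,
    (x ^ 6 - x ^ 7) * v 0 + (x ^ 5 - x ^ 8) * v 1 + (x ^ 2 - x ^ 11) * v 2
      - (x ^ 4 - x ^ 9) * v 3 + (x - x ^ 12) * v 4 + (x ^ 3 - x ^ 10) * v 5]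

/-- The quadratic Gauss sum modulo 13. -/
def gaussSum13 (x : ℂ) : ℂ := 1 + 2 * (x + x ^ 4 + x ^ 9 + x ^ 3 + x ^ 12 + x ^ 10)

theorem gaussSum13_sq {x : ℂ} (h : 1 + x + x ^ 2 + x ^ 3 + x ^ 4 + x ^ 5 + x ^ 6 + x ^ 7
    + x ^ 8 + x ^ 9 + x ^ 10 + x ^ 11 + x ^ 12 = 0) : gaussSum13 x ^ 2 = 13 := by
  unfold gaussSum13
  grind

set_option maxRecDepth 100000 in
theorem AA0_sMat {x : ℂ} (h : 1 + x + x ^ 2 + x ^ 3 + x ^ 4 + x ^ 5 + x ^ 6 + x ^ 7 + x ^ 8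
    + x ^ 9 + x ^ 10 + x ^ 11 + x ^ 12 = 0) (v : Fin 6 → ℂ) :
    AA0 (sMat x v) = gaussSum13 x * (AA0 v + AA1 v + AA2 v + AA3 v + AA4 v + AA5 v + AA6 v) := by
  simp only [AA0, AA1, AA2, AA3, AA4, AA5, AA6, sMat, gaussSum13, Matrix.cons_val]
  generalize v 0 = a, v 1 = b, v 2 = c, v 3 = d, v 4 = e, v 5 = f
  grind

set_option maxRecDepth 100000 in
theorem AA1_sMat {x : ℂ} (h : 1 + x + x ^ 2 + x ^ 3 + x ^ 4 + x ^ 5 + x ^ 6 + x ^ 7 + x ^ 8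
    + x ^ 9 + x ^ 10 + x ^ 11 + x ^ 12 = 0) (v : Fin 6 → ℂ) :
    AA1 (sMat x v) = gaussSum13 x * (2 * AA0 v
       + (x ^ 2 + x ^ 11) * AA1 v + (x ^ 4 + x ^ 9) * AA2 v + (x ^ 6 + x ^ 7) * AA3 v
       + (x ^ 5 + x ^ 8) * AA4 v + (x ^ 3 + x ^ 10) * AA5 v + (x + x ^ 12) * AA6 v) := by
  simp only [AA0, AA1, AA2, AA3, AA4, AA5, AA6, sMat, gaussSum13, Matrix.cons_val]
  generalize v 0 = a, v 1 = b, v 2 = c, v 3 = d, v 4 = e, v 5 = f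
  grind

set_option maxRecDepth 100000 in
theorem AA2_sMat {x : ℂ} (h : 1 + x + x ^ 2 + x ^ 3 + x ^ 4 + x ^ 5 + x ^ 6 + x ^ 7 + x ^ 8
    + x ^ 9 + x ^ 10 + x ^ 11 + x ^ 12 = 0) (v : Fin 6 → ℂ) :
    AA2 (sMat x v) = gaussSum13 x * (2 * AA0 v
       + (x ^ 4 + x ^ 9) * AA1 v + (x ^ 5 + x ^ 8) * AA2 v + (x + x ^ 12) * AA3 v
       + (x ^ 3 + x ^ 10) * AA4 v + (x ^ 6 + x ^ 7) * AA5 v + (x ^ 2 + x ^ 11) * AA6 v) := by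
  simp only [AA0, AA1, AA2, AA3, AA4, AA5, AA6, sMat, gaussSum13, Matrix.cons_val]
  generalize v 0 = a, v 1 = b, v 2 = c, v 3 = d, v 4 = e, v 5 = f
  grind

set_option maxRecDepth 100000 in
theorem AA3_sMat {x : ℂ} (h : 1 + x + x ^ 2 + x ^ 3 + x ^ 4 + x ^ 5 + x ^ 6 + x ^ 7 + x ^ 8
    + x ^ 9 + x ^ 10 + x ^ 11 + x ^ 12 = 0) (v : Fin 6 → ℂ) :
    AA3 (sMat x v) = gaussSum13 x * (2 * AA0 v
       + (x ^ 6 + x ^ 7) * AA1 v + (x + x ^ 12) * AA2 v + (x ^ 5 + x ^ 8) * AA3 v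
       + (x ^ 2 + x ^ 11) * AA4 v + (x ^ 4 + x ^ 9) * AA5 v + (x ^ 3 + x ^ 10) * AA6 v) := by
  simp only [AA0, AA1, AA2, AA3, AA4, AA5, AA6, sMat, gaussSum13, Matrix.cons_val]
  generalize v 0 = a, v 1 = b, v 2 = c, v 3 = d, v 4 = e, v 5 = f
  grind

set_option maxRecDepth 100000 in
theorem AA4_sMat {x : ℂ} (h : 1 + x + x ^ 2 + x ^ 3 + x ^ 4 + x ^ 5 + x ^ 6 + x ^ 7 + x ^ 8
    + x ^ 9 + x ^ 10 + x ^ 11 + x ^ 12 = 0) (v : Fin 6 → ℂ) :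
    AA4 (sMat x v) = gaussSum13 x * (2 * AA0 v
       + (x ^ 5 + x ^ 8) * AA1 v + (x ^ 3 + x ^ 10) * AA2 v + (x ^ 2 + x ^ 11) * AA3 v
       + (x ^ 6 + x ^ 7) * AA4 v + (x + x ^ 12) * AA5 v + (x ^ 4 + x ^ 9) * AA6 v) := by
  simp only [AA0, AA1, AA2, AA3, AA4, AA5, AA6, sMat, gaussSum13, Matrix.cons_val]
  generalize v 0 = a, v 1 = b, v 2 = c, v 3 = d, v 4 = e, v 5 = f
  grind

set_option maxRecDepth 100000 in
theorem AA5_sMat {x : ℂ} (h : 1 + x + x ^ 2 + x ^ 3 + x ^ 4 + x ^ 5 + x ^ 6 + x ^ 7 + x ^ 8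
    + x ^ 9 + x ^ 10 + x ^ 11 + x ^ 12 = 0) (v : Fin 6 → ℂ) :
    AA5 (sMat x v) = gaussSum13 x * (2 * AA0 v
       + (x ^ 3 + x ^ 10) * AA1 v + (x ^ 6 + x ^ 7) * AA2 v + (x ^ 4 + x ^ 9) * AA3 v
       + (x + x ^ 12) * AA4 v + (x ^ 2 + x ^ 11) * AA5 v + (x ^ 5 + x ^ 8) * AA6 v) := by
  simp only [AA0, AA1, AA2, AA3, AA4, AA5, AA6, sMat, gaussSum13, Matrix.cons_val]
  generalize v 0 = a, v 1 = b, v 2 = c, v 3 = d, v 4 = e, v 5 = f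
  grind

set_option maxRecDepth 100000 in
theorem AA6_sMat {x : ℂ} (h : 1 + x + x ^ 2 + x ^ 3 + x ^ 4 + x ^ 5 + x ^ 6 + x ^ 7 + x ^ 8
    + x ^ 9 + x ^ 10 + x ^ 11 + x ^ 12 = 0) (v : Fin 6 → ℂ) :
    AA6 (sMat x v) = gaussSum13 x * (2 * AA0 v
       + (x + x ^ 12) * AA1 v + (x ^ 2 + x ^ 11) * AA2 v + (x ^ 3 + x ^ 10) * AA3 v
       + (x ^ 4 + x ^ 9) * AA4 v + (x ^ 5 + x ^ 8) * AA5 v + (x ^ 6 + x ^ 7) * AA6 v) := by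
  simp only [AA0, AA1, AA2, AA3, AA4, AA5, AA6, sMat, gaussSum13, Matrix.cons_val]
  generalize v 0 = a, v 1 = b, v 2 = c, v 3 = d, v 4 = e, v 5 = f
  grind


/-- The form `AA0 + ∑ x ^ (i ^ 2 ν) AAi` whose square at `x = ζ` is `wF ν`. -/
def linF (x : ℂ) (ν : ℕ) (v : Fin 6 → ℂ) : ℂ :=
  AA0 v + x ^ ν * AA1 v + x ^ (4 * ν) * AA2 v + x ^ (9 * ν) * AA3 v + x ^ (3 * ν) * AA4 v
    + x ^ (12 * ν) * AA5 v + x ^ (10 * ν) * AA6 v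

theorem linF_zero_sMat {x : ℂ} (h : 1 + x + x ^ 2 + x ^ 3 + x ^ 4 + x ^ 5 + x ^ 6 + x ^ 7 + x ^ 8
    + x ^ 9 + x ^ 10 + x ^ 11 + x ^ 12 = 0) (v : Fin 6 → ℂ) :
    linF x 0 (sMat x v) = gaussSum13 x * (13 * AA0 v) := by
  simp only [linF, AA0_sMat h, AA1_sMat h, AA2_sMat h, AA3_sMat h, AA4_sMat h, AA5_sMat h,
    AA6_sMat h]
  linear_combination gaussSum13 x * (AA1 v + AA2 v + AA3 v + AA4 v + AA5 v + AA6 v) * h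

set_option maxRecDepth 100000 in
theorem linF_sMat {x : ℂ} (h : 1 + x + x ^ 2 + x ^ 3 + x ^ 4 + x ^ 5 + x ^ 6 + x ^ 7 + x ^ 8
    + x ^ 9 + x ^ 10 + x ^ 11 + x ^ 12 = 0) (v : Fin 6 → ℂ) {ν : ℕ} (hν : ν ∈ Finset.Icc 1 12) :
    linF x ν (sMat x v) =
      (if ν ^ 6 % 13 = 1 then 13 else -13) * linF x (12 * ν ^ 11 % 13) v := by
  have e (n : ℕ) : x ^ (n + 13) = x ^ n := by linear_combination x ^ n * (x - 1) * h
  simp only [linF, AA0_sMat h, AA1_sMat h, AA2_sMat h, AA3_sMat h, AA4_sMat h, AA5_sMat h,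
    AA6_sMat h, gaussSum13]
  generalize AA0 v = a0, AA1 v = a1, AA2 v = a2, AA3 v = a3, AA4 v = a4, AA5 v = a5, AA6 v = a6
  rw [Finset.mem_Icc] at hν
  obtain ⟨h1, h2⟩ := hν
  interval_cases ν <;> norm_num only [e, if_true, if_false, pow_zero] <;> clear e h1 h2 <;> grind

theorem ζ_isPrimitiveRoot : IsPrimitiveRoot ζ 13 := by
  have := Complex.isPrimitiveRoot_exp 13 (by norm_num)
  simpa [ζ] using this

theorem ζ_geom_sum : 1 + ζ + ζ ^ 2 + ζ ^ 3 + ζ ^ 4 + ζ ^ 5 + ζ ^ 6 + ζ ^ 7 + ζ ^ 8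
    + ζ ^ 9 + ζ ^ 10 + ζ ^ 11 + ζ ^ 12 = 0 := by
  simpa [Finset.sum_range_succ] using ζ_isPrimitiveRoot.geom_sum_eq_zero (by norm_num)

theorem Phi20_eq_linF (v : Fin 6 → ℂ) :
    Phi20 v = 1 / 325 * ((∑ ν ∈ Finset.range 13, linF ζ ν v ^ 10) + 13 ^ 5 * AA0 v ^ 10) := by
  have h (ν : ℕ) : wF ν v ^ 5 = linF ζ ν v ^ 10 := by rw [wF, linF, ← pow_mul]
  simp only [Phi20, h, wInf]
  ring

theorem Phi20_smul (c : ℂ) (v : Fin 6 → ℂ) : Phi20 (c • v) = c ^ 20 * Phi20 v := by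
  have h (ν : ℕ) : linF ζ ν (c • v) = c ^ 2 * linF ζ ν v := by
    simp only [linF, AA0, AA1, AA2, AA3, AA4, AA5, AA6, Pi.smul_apply, smul_eq_mul]
    ring
  have h0 : AA0 (c • v) = c ^ 2 * AA0 v := by
    simp only [AA0, Pi.smul_apply, smul_eq_mul]
    ring
  simp only [Phi20_eq_linF, h, h0, mul_pow, ← Finset.mul_sum]
  ring

theorem Phi20_sMat (v : Fin 6 → ℂ) : Phi20 (sMat ζ v) = 13 ^ 10 * Phi20 v := by
  have hg : gaussSum13 ζ ^ 10 = 13 ^ 5 := by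
    rw [show 10 = 2 * 5 from rfl, pow_mul, gaussSum13_sq ζ_geom_sum]
  have h0 : AA0 (sMat ζ v) = gaussSum13 ζ * linF ζ 0 v := by
    rw [AA0_sMat ζ_geom_sum]
    simp only [linF]
    ring
  have h (ν : ℕ) (hν : ν ∈ Finset.Icc 1 12) :
      linF ζ ν (sMat ζ v) ^ 10 = 13 ^ 10 * linF ζ (12 * ν ^ 11 % 13) v ^ 10 := by
    rw [linF_sMat ζ_geom_sum v hν, mul_pow]
    split_ifs <;> norm_num
  simp only [Phi20_eq_linF, Finset.sum_range_succ, Finset.sum_range_zero, zero_add, h0,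
    linF_zero_sMat ζ_geom_sum, mul_pow, hg, h, Finset.mem_Icc, Nat.reduceLeDiff, and_self]
  norm_num only
  ring

theorem even_theta_exponent {k : ℤ} (hk : Odd k) (n : ℤ) : Even (13 * n ^ 2 + k * n) := by
  obtain ⟨j, rfl⟩ := hk
  rcases Int.even_or_odd' n with ⟨m, rfl | rfl⟩
  · exact ⟨26 * m ^ 2 + (2 * j + 1) * m, by ring⟩
  · exact ⟨26 * m ^ 2 + 26 * m + 7 + 2 * j * m + m + j, by ring⟩

theorem th13_add_one (c : ℚ) {k : ℤ} (hk : Odd k) (z : ℂ) :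
    th13 c k (z + 1) = cexp (2 * Real.pi * I * c) * th13 c k z := by
  have h (n : ℤ) : cexp (2 * Real.pi * I * (((13 * n ^ 2 + k * n : ℤ) : ℂ) / 2) * (z + 1)) =
      cexp (2 * Real.pi * I * (((13 * n ^ 2 + k * n : ℤ) : ℂ) / 2) * z) := by
    obtain ⟨j, hj⟩ := even_theta_exponent hk n
    rw [hj, ← (Complex.exp_periodic.int_mul j) (2 * Real.pi * I * (((j + j : ℤ) : ℂ) / 2) * z)]
    congr 1
    push_cast
    ring
  simp only [th13, h]
  rw [mul_add, Complex.exp_add, mul_one]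
  ring

theorem AA0_linF_AV_add_one (z : ℂ) : AA0 (AV (z + 1)) = I * AA0 (AV z) ∧
    ∀ ν, linF ζ ν (AV (z + 1)) = I * linF ζ (ν + 1) (AV z) := by
  set w := cexp (2 * Real.pi * I / 104) with hw
  have e (n : ℕ) : cexp (2 * Real.pi * I * (n / 104 : ℚ)) = w ^ n := by
    rw [hw, ← Complex.exp_nat_mul]
    congr 1
    push_cast
    ring
  have hζ : ζ = w ^ 8 := by
    rw [hw, ζ, ← Complex.exp_nat_mul]
    congr 1
    push_cast
    ring
  have hI : I = w ^ 26 := by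
    rw [hw, ← Complex.exp_nat_mul]
    refine Complex.exp_pi_div_two_mul_I.symm.trans ?_
    congr 1
    push_cast
    ring
  have h1 : w ^ 104 = 1 := by
    rw [hw, ← Complex.exp_nat_mul, ← Complex.exp_two_pi_mul_I]
    congr 1
    push_cast
    ring
  have hv : AV (z + 1) = ![w ^ 121 * AV z 0, w ^ 49 * AV z 1, w ^ 25 * AV z 2, w ^ 9 * AV z 3,
      w ^ 81 * AV z 4, w ^ 1 * AV z 5] := by
    ext i
    fin_cases i <;> simp [AV, ta, th13_add_one, ← e, show Odd (11 : ℤ) by decide,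
      show Odd (7 : ℤ) by decide, show Odd (5 : ℤ) by decide, show Odd (3 : ℤ) by decide,
      show Odd (9 : ℤ) by decide]
  have hq : w ^ 121 = w ^ 17 := by linear_combination w ^ 17 * h1
  rw [hv, hq, hI]
  constructor
  · simp only [AA0, Matrix.cons_val]
    linear_combination w ^ 26 * AV z 1 * AV z 4 * h1
  intro ν
  simp only [linF, AA0, AA1, AA2, AA3, AA4, AA5, AA6, Matrix.cons_val, mul_add, pow_add, pow_mul',
    mul_one]
  generalize ζ ^ ν = X
  rw [hζ]
  generalize AV z = v
  linear_combination (w ^ 26 * v 1 * v 4 - X ^ 4 * w ^ 58 * v 4 ^ 2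
    - X ^ 12 * w ^ 18 * (-v 3 ^ 2 - 2 * v 0 * v 5) + X ^ 10 * w ^ 2 * v 5 ^ 2) * h1

theorem Phi20_AV_add_one (z : ℂ) : Phi20 (AV (z + 1)) = -Phi20 (AV z) := by
  have hI : I ^ 10 = -1 := by
    rw [show 10 = 2 * 5 from rfl, pow_mul, I_sq]
    norm_num
  obtain ⟨h0, h⟩ := AA0_linF_AV_add_one z
  have h13 : linF ζ 13 (AV z) = linF ζ 0 (AV z) := by
    have hk (k : ℕ) : ζ ^ (k * 13) = 1 := by
      rw [mul_comm, pow_mul, ζ_isPrimitiveRoot.pow_eq_one, one_pow]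
    simp only [linF, hk, mul_zero, pow_zero, ζ_isPrimitiveRoot.pow_eq_one]
  simp only [Phi20_eq_linF, h, h0, mul_pow, hI, Finset.sum_range_succ,
    Finset.sum_range_zero, zero_add, h13]
  ring

theorem etaF_eq_eta : etaF = ModularForm.eta := by
  ext z
  simp [etaF, ModularForm.eta, ModularForm.eta_q, Function.Periodic.qParam]

theorem etaF_ne_zero {z : ℂ} (hz : 0 < z.im) : etaF z ≠ 0 := by
  rw [etaF_eq_eta]
  exact ModularForm.eta_ne_zero hz

theorem differentiableAt_etaF {z : ℂ} (hz : 0 < z.im) : DifferentiableAt ℂ etaF z := by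
  rw [etaF_eq_eta]
  exact ModularForm.differentiableAt_eta_of_mem_upperHalfPlaneSet hz

theorem etaF_add_one_pow (z : ℂ) : etaF (z + 1) ^ 12 = -etaF z ^ 12 := by
  have h : cexp (2 * Real.pi * I * (z + 1)) = cexp (2 * Real.pi * I * z) := by
    rw [mul_add, mul_one, Complex.exp_periodic]
  have h2 : cexp (2 * Real.pi * I * (z + 1) / 24) ^ 12 =
      -cexp (2 * Real.pi * I * z / 24) ^ 12 := by
    rw [← Complex.exp_nat_mul, ← Complex.exp_nat_mul, ← neg_one_mul, ← Complex.exp_pi_mul_I,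
      ← Complex.exp_add]
    congr 1
    push_cast
    ring
  simp only [etaF, h, mul_pow, h2, neg_mul]

theorem etaF_neg_inv_pow {z : ℂ} (hz : 0 < z.im) :
    etaF (-1 / z) ^ 12 = -(z ^ 6 * etaF z ^ 12) := by
  have h : etaF (-1 / z) = (sqrt I)⁻¹ * (sqrt z * etaF z) := by
    rw [etaF_eq_eta]
    exact ModularForm.eta_comp_eq_csqrt_I_inv hz
  have hs {w : ℂ} (hw : w ≠ 0) : sqrt w ^ 12 = w ^ 6 := by
    rw [sqrt_eq_exp hw, ← Complex.exp_nat_mul]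
    conv_rhs => rw [← Complex.exp_log hw, ← Complex.exp_nat_mul]
    congr 1
    push_cast
    ring
  have hI : I ^ 6 = -1 := by
    rw [show 6 = 2 * 3 from rfl, pow_mul, I_sq]
    norm_num
  rw [h, mul_pow, mul_pow, inv_pow, hs I_ne_zero, hI, hs (by rintro rfl; simp at hz)]
  ring

theorem th13_eq_jacobiTheta₂ (c : ℚ) (k : ℤ) (z : ℂ) :
    th13 c k z = cexp (2 * Real.pi * I * c * z) * jacobiTheta₂ ((k * z + 1) / 2) (13 * z) := by
  rw [th13, jacobiTheta₂]
  congr 1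
  refine tsum_congr fun n => ?_
  rw [jacobiTheta₂_term, ← Complex.exp_pi_mul_I, ← Complex.exp_int_mul, ← Complex.exp_add]
  congr 1
  push_cast
  ring

theorem differentiableAt_th13 (c : ℚ) (k : ℤ) {z : ℂ} (hz : 0 < z.im) :
    DifferentiableAt ℂ (th13 c k) z := by
  have h : th13 c k = fun z => cexp (2 * Real.pi * I * c * z) *
      jacobiTheta₂ ((k * z + 1) / 2) (13 * z) := funext (th13_eq_jacobiTheta₂ c k)
  have h13 : 0 < (13 * z).im := by simpa using hz
  rw [h]
  refine DifferentiableAt.mul (by fun_prop) ?_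
  exact DifferentiableAt.comp (f := fun z : ℂ => ((k * z + 1) / 2, 13 * z)) z
    (hasFDerivAt_jacobiTheta₂ _ h13).differentiableAt (by fun_prop)

theorem differentiableAt_AV {z : ℂ} (hz : 0 < z.im) (i : Fin 6) :
    DifferentiableAt ℂ (fun z => AV z i) z := by
  have h (c : ℚ) (k : ℤ) := differentiableAt_th13 c k hz
  fin_cases i <;> first | exact h _ _ | exact (h _ _).neg

theorem differentiableAt_Phi20_AV {z : ℂ} (hz : 0 < z.im) :
    DifferentiableAt ℂ (fun z => Phi20 (AV z)) z := by
  have h := differentiableAt_AV hz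
  simp only [Phi20, wF, wInf, AA0, AA1, AA2, AA3, AA4, AA5, AA6]
  fun_prop

theorem th13_sq_eq_tsum (k : ℤ) (z : ℂ) : th13 (k ^ 2 / 104) k z =
    ∑' n : ℤ, (-1 : ℂ) ^ n * cexp (2 * Real.pi * I * ((26 * n + k) ^ 2 / 104) * z) := by
  rw [th13, ← tsum_mul_left]
  refine tsum_congr fun n => ?_
  rw [mul_left_comm, ← Complex.exp_add]
  congr 2
  push_cast
  ring

theorem th13_sq_neg (k : ℤ) (z : ℂ) : th13 (((-k : ℤ) : ℚ) ^ 2 / 104) (-k) z =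
    th13 (k ^ 2 / 104) k z := by
  rw [th13_sq_eq_tsum, th13_sq_eq_tsum, ← (Equiv.neg ℤ).tsum_eq]
  refine tsum_congr fun n => ?_
  simp only [Equiv.neg_apply, zpow_neg, inv_neg_one, ← inv_zpow]
  congr 2
  push_cast
  ring

theorem th13_sq_thirteen (z : ℂ) : th13 (((13 : ℤ) : ℚ) ^ 2 / 104) 13 z = 0 := by
  rw [th13_sq_eq_tsum, ← CharZero.eq_neg_self_iff, ← tsum_neg]
  conv_lhs => rw [← (Equiv.subLeft (-1 : ℤ)).tsum_eq]
  refine tsum_congr fun n => ?_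
  simp only [Equiv.subLeft_apply]
  rw [zpow_sub₀ (by norm_num), zpow_neg_one, div_eq_mul_inv, ← inv_zpow, inv_neg_one, neg_one_mul,
    neg_mul]
  congr 3
  push_cast
  ring

theorem jacobiTheta₂_eq_sum_th13 {k : ℤ} (hk : Odd k) {z : ℂ} (hz : 0 < z.im) :
    cexp (Real.pi * I * (z / 52 - k / 26)) * jacobiTheta₂ ((k - z) / 26) (z / 13) =
      ∑ s ∈ Finset.range 13, cexp (Real.pi * I * (k * ((2 * s - 11 : ℤ) : ℂ) / 26)) *
        th13 (((2 * s - 11 : ℤ) : ℚ) ^ 2 / 104) (2 * s - 11) z := by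
  have h13 : 0 < (z / 13).im := by simpa using hz
  let e : Fin 13 × ℤ ≃ ℤ :=
    ((Equiv.prodComm _ _).trans (Int.divModEquiv 13).symm).trans (Equiv.subRight 5)
  have hs := ((hasSum_jacobiTheta₂_term ((k - z) / 26) h13).mul_left
    (cexp (Real.pi * I * (z / 52 - k / 26))))
  rw [← e.hasSum_iff] at hs
  rw [← hs.tsum_eq, hs.summable.tsum_prod, tsum_fintype, Finset.sum_range]
  refine Finset.sum_congr rfl fun s _ => ?_
  rw [th13_sq_eq_tsum, ← tsum_mul_left]
  refine tsum_congr fun n => ?_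
  have hkn : (-1 : ℂ) ^ n = (-1) ^ (k * n) := by
    rw [zpow_mul, hk.neg_one_zpow]
  rw [hkn, ← Complex.exp_pi_mul_I, ← Complex.exp_int_mul, ← Complex.exp_add, ← Complex.exp_add,
    Function.comp_apply, jacobiTheta₂_term, ← Complex.exp_add]
  congr 1
  simp [e]
  ring

theorem th13_sq_neg_inv {k : ℤ} (hk : Odd k) {z : ℂ} (hz : 0 < z.im) :
    th13 (k ^ 2 / 104) k (-1 / z) = 1 / (13 * I / z) ^ (1 / 2 : ℂ) *
      ∑ s ∈ Finset.range 13, cexp (Real.pi * I * (k * ((2 * s - 11 : ℤ) : ℂ) / 26)) *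
        th13 (((2 * s - 11 : ℤ) : ℚ) ^ 2 / 104) (2 * s - 11) z := by
  have hz0 : z ≠ 0 := by rintro rfl; simp at hz
  rw [← jacobiTheta₂_eq_sum_th13 hk hz, th13_eq_jacobiTheta₂, jacobiTheta₂_functional_equation,
    show -I * (13 * (-1 / z)) = 13 * I / z by ring,
    show (k * (-1 / z) + 1) / 2 / (13 * (-1 / z)) = (k - z) / 26 by field_simp; ring,
    show -1 / (13 * (-1 / z)) = z / 13 by field_simp, ← mul_assoc, ← mul_assoc, ← mul_assoc,
    mul_comm (cexp _) (1 / _), mul_assoc (1 / _), ← Complex.exp_add]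
  congr 3
  push_cast
  field_simp
  ring

theorem AV_neg_inv {z : ℂ} (hz : 0 < z.im) :
    ∃ c : ℂ, c ^ 20 = -(z / 13) ^ 10 ∧ AV (-1 / z) = c • sMat ζ (AV z) := by
  have hz0 : z ≠ 0 := by rintro rfl; simp at hz
  refine ⟨-I * (1 / (13 * I / z) ^ (1 / 2 : ℂ)), ?_, ?_⟩
  · have hI : I ^ 10 = -1 := by
      rw [show 10 = 2 * 5 from rfl, pow_mul, I_sq]
      norm_num
    have h : ((13 * I / z) ^ (1 / 2 : ℂ)) ^ 20 = (13 * I / z) ^ 10 := by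
      rw [← Complex.cpow_nat_mul, ← Complex.cpow_natCast]
      norm_num
    rw [mul_pow, div_pow, h, neg_pow, show 20 = 10 * 2 from rfl, pow_mul, pow_mul, hI, div_pow,
      mul_pow, hI]
    field_simp
    norm_num
  set w := cexp (Real.pi * I / 26) with hw
  have hζ : ζ = w ^ 4 := by
    rw [hw, ζ, ← Complex.exp_nat_mul]
    congr 1
    push_cast
    ring
  have hI : -I = w ^ 39 := by
    rw [← I_pow_three, hw, ← Complex.exp_nat_mul]
    conv_lhs => rw [← Complex.exp_pi_div_two_mul_I, ← Complex.exp_nat_mul]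
    congr 1
    push_cast
    ring
  have h26 (n : ℕ) : w ^ (n + 26) = -w ^ n := by
    rw [pow_add, ← neg_one_mul, mul_comm, hw, ← Complex.exp_nat_mul, ← Complex.exp_pi_mul_I]
    congr 2
    push_cast
    ring
  have hexp (m : ℕ) : cexp (Real.pi * I * ((m : ℤ) / 26)) = w ^ m := by
    rw [hw, ← Complex.exp_nat_mul]
    congr 1
    push_cast
    ring
  have hexp' {m : ℕ} (hm : m ≤ 156) : cexp (Real.pi * I * ((-m : ℤ) / 26)) = w ^ (156 - m) := by
    rw [hw, ← Complex.exp_nat_mul, ← (Complex.exp_periodic.int_mul 3), Nat.cast_sub hm]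
    congr 1
    push_cast
    ring
  have hS {k : ℕ} (hk : Odd k) (hk' : k ≤ 12) : th13 ((k : ℤ) ^ 2 / 104) k (-1 / z) =
      1 / (13 * I / z) ^ (1 / 2 : ℂ) * ∑ j ∈ Finset.range 6,
        (w ^ (k * (2 * j + 1)) + w ^ (156 - k * (2 * j + 1))) *
          th13 (((2 * j + 1 : ℕ) : ℤ) ^ 2 / 104) (2 * j + 1 : ℕ) z := by
    have hk1 : Odd (k : ℤ) := by exact_mod_cast hk
    rw [th13_sq_neg_inv hk1 hz]
    congr 1
    have hp (r : ℕ) : cexp (Real.pi * I * ((k : ℤ) * (r : ℤ) / 26)) = w ^ (k * r) := by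
      rw [← hexp]
      push_cast
      rfl
    have hm (r : ℕ) (hr : r ≤ 12) : cexp (Real.pi * I * ((k : ℤ) * (-r : ℤ) / 26)) =
        w ^ (156 - k * r) := by
      rw [← hexp' (by nlinarith)]
      push_cast
      ring_nf
    have hF (F : ℤ → ℂ) : ∑ s ∈ Finset.range 13, F (2 * s - 11) =
        ∑ j ∈ Finset.range 6, (F (2 * j + 1 : ℕ) + F (-(2 * j + 1 : ℕ))) + F 13 := by
      norm_num [Finset.sum_range_succ]
      ring
    rw [hF fun r => cexp (Real.pi * I * ((k : ℤ) * (r : ℂ) / 26)) * th13 ((r : ℚ) ^ 2 / 104) r z,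
      th13_sq_thirteen, mul_zero, add_zero]
    refine Finset.sum_congr rfl fun j hj => ?_
    have hj' := Finset.mem_range.1 hj
    rw [th13_sq_neg, hp, hm _ (by omega), add_mul]
  have hAV (w : ℂ) : AV w = ![th13 (((11 : ℕ) : ℤ) ^ 2 / 104) (11 : ℕ) w,
      th13 (((7 : ℕ) : ℤ) ^ 2 / 104) (7 : ℕ) w, th13 (((5 : ℕ) : ℤ) ^ 2 / 104) (5 : ℕ) w,
      -th13 (((3 : ℕ) : ℤ) ^ 2 / 104) (3 : ℕ) w, th13 (((9 : ℕ) : ℤ) ^ 2 / 104) (9 : ℕ) w,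
      th13 (((1 : ℕ) : ℤ) ^ 2 / 104) (1 : ℕ) w] := by
    ext i
    fin_cases i <;> norm_num [AV, ta]
  rw [hAV, hS (by decide) (by norm_num), hS (by decide) (by norm_num), hS (by decide) (by norm_num),
    hS (by decide) (by norm_num), hS (by decide) (by norm_num), hS (by decide) (by norm_num), hAV z,
    hζ, hI]
  simp only [Finset.sum_range_succ, Finset.sum_range_zero, Nat.reduceMul, Nat.reduceAdd,
    Nat.reduceSub, mul_zero, zero_add, mul_one, one_mul, h26]
  generalize th13 (((1 : ℕ) : ℤ) ^ 2 / 104) (1 : ℕ) z = t1, th13 (((3 : ℕ) : ℤ) ^ 2 / 104) (3 : ℕ) z = t3,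
    th13 (((5 : ℕ) : ℤ) ^ 2 / 104) (5 : ℕ) z = t5, th13 (((7 : ℕ) : ℤ) ^ 2 / 104) (7 : ℕ) z = t7,
    th13 (((9 : ℕ) : ℤ) ^ 2 / 104) (9 : ℕ) z = t9, th13 (((11 : ℕ) : ℤ) ^ 2 / 104) (11 : ℕ) z = t11
  generalize 1 / (13 * I / z) ^ (1 / 2 : ℂ) = C
  have h : w ^ 26 = -1 := by simpa using h26 0
  clear hS hAV hexp hexp' h26 hI hζ
  clear_value w
  ext i
  fin_cases i <;> simp [sMat, ← pow_mul] <;> grind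

theorem Phi20_AV_neg_inv {z : ℂ} (hz : 0 < z.im) :
    Phi20 (AV (-1 / z)) = -z ^ 10 * Phi20 (AV z) := by
  obtain ⟨c, hc, h⟩ := AV_neg_inv hz
  rw [h, Phi20_smul, Phi20_sMat, hc]
  ring

/-- The series `θ` with `∑ n, (-1) ^ n * q ^ ((13 * n ^ 2 + k * n) / 2) = 1 + u ^ 4 * θ`, where
`q = u ^ 13`. -/
def thetaTail (k : ℤ) (u : ℂ) : ℂ :=
  ∑' n : ℤ, if n = 0 then 0 else (-1 : ℂ) ^ n * u ^ (13 * ((13 * n ^ 2 + k * n) / 2).toNat - 4)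

theorem natAbs_le_thetaTail_exponent {k n : ℤ} (hk : |k| ≤ 11) (hn : n ≠ 0) :
    n.natAbs + 4 ≤ 13 * ((13 * n ^ 2 + k * n) / 2).toNat := by
  have h1 : 1 ≤ |n| := Int.one_le_abs hn
  have h2 : -(11 * |n|) ≤ k * n := by
    refine (neg_le_neg ?_).trans (neg_abs_le _)
    rw [abs_mul]
    gcongr
  have h3 : |n| ≤ n ^ 2 := by rw [← sq_abs]; nlinarith
  rw [Int.abs_eq_natAbs n] at *
  omega

theorem norm_thetaTail_term_le {k : ℤ} (hk : |k| ≤ 11) (n : ℤ) {u : ℂ} (hu : ‖u‖ ≤ 1 / 2) :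
    ‖if n = 0 then 0 else (-1 : ℂ) ^ n * u ^ (13 * ((13 * n ^ 2 + k * n) / 2).toNat - 4)‖ ≤
      (1 / 2 : ℝ) ^ n.natAbs := by
  split_ifs with hn
  · simp
  · rw [norm_mul, norm_zpow, norm_neg, norm_one, one_zpow, one_mul, norm_pow]
    have h := natAbs_le_thetaTail_exponent hk hn
    exact (pow_le_pow_left₀ (norm_nonneg _) hu _).trans
      (pow_le_pow_of_le_one (by norm_num) (by norm_num) (by omega))

theorem summable_half_pow_natAbs : Summable fun n : ℤ => (1 / 2 : ℝ) ^ n.natAbs := by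
  apply Summable.of_nat_of_neg <;> simpa using summable_geometric_two

theorem tendsto_thetaTail {k : ℤ} (hk : |k| ≤ 11) :
    Filter.Tendsto (thetaTail k) (nhds 0) (nhds 0) := by
  suffices h : Filter.Tendsto (thetaTail k) (nhds 0) (nhds (∑' _ : ℤ, (0 : ℂ))) by simpa using h
  refine tendsto_tsum_of_dominated_convergence summable_half_pow_natAbs (fun n => ?_) ?_
  · by_cases hn : n = 0
    · simp [hn]
    · have h := natAbs_le_thetaTail_exponent hk hn
      have h0 : 13 * ((13 * n ^ 2 + k * n) / 2).toNat - 4 ≠ 0 := by omega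
      simp only [hn, if_false]
      have hc : Continuous fun u : ℂ => (-1 : ℂ) ^ n *
        u ^ (13 * ((13 * n ^ 2 + k * n) / 2).toNat - 4) := by fun_prop
      simpa [h0] using hc.tendsto 0
  · filter_upwards [Metric.closedBall_mem_nhds (0 : ℂ) (by norm_num : (0 : ℝ) < 1 / 2)] with u hu n
    exact norm_thetaTail_term_le hk n (mem_closedBall_zero_iff.1 hu)

theorem th13_sq_eq_thetaTail {k : ℤ} (hk : Odd k) (hk' : |k| ≤ 11) {z : ℂ}
    (hz : ‖cexp (2 * Real.pi * I * z / 13)‖ ≤ 1 / 2) :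
    th13 (k ^ 2 / 104) k z = cexp (2 * Real.pi * I * z / 104) ^ (k ^ 2).toNat *
      (1 + cexp (2 * Real.pi * I * z / 13) ^ 4 *
        thetaTail k (cexp (2 * Real.pi * I * z / 13))) := by
  set u := cexp (2 * Real.pi * I * z / 13) with hu
  have hs : HasSum _ (thetaTail k u) :=
    (Summable.of_norm_bounded summable_half_pow_natAbs
      fun n => norm_thetaTail_term_le hk' n hz).hasSum
  have h1 : HasSum (fun n : ℤ => if n = 0 then (1 : ℂ) else 0) 1 := hasSum_ite_eq 0 1
  rw [th13, ← (h1.add (hs.mul_left (u ^ 4))).tsum_eq]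
  congr 1
  · rw [← Complex.exp_nat_mul]
    congr 1
    have : (((k ^ 2).toNat : ℤ) : ℂ) = k ^ 2 := by
      rw [Int.toNat_of_nonneg (sq_nonneg k)]
      push_cast
      rfl
    rw [← Int.cast_natCast, this]
    push_cast
    ring
  · refine tsum_congr fun n => ?_
    by_cases hn : n = 0
    · simp [hn]
    have h := natAbs_le_thetaTail_exponent hk' hn
    have he : 2 * ((((13 * n ^ 2 + k * n) / 2).toNat : ℕ) : ℤ) = 13 * n ^ 2 + k * n := by
      obtain ⟨j, hj⟩ := even_theta_exponent hk n
      omega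
    generalize ((13 * n ^ 2 + k * n) / 2).toNat = e at h he ⊢
    rw [← he]
    simp only [hn, if_false, zero_add]
    rw [mul_left_comm, ← pow_add, Nat.add_sub_cancel' (by omega), hu, ← Complex.exp_nat_mul]
    congr 2
    push_cast
    ring

/-- The vector of theta constants, with the factor `1 + u ^ 4 * D i` standing for the
normalized `q`-series of the `i`-th one. -/
def seriesVec (s : ℂ) (D : Fin 6 → ℂ) : Fin 6 → ℂ :=
  ![s ^ 121 * (1 + (s ^ 8) ^ 4 * D 0), s ^ 49 * (1 + (s ^ 8) ^ 4 * D 1),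
    s ^ 25 * (1 + (s ^ 8) ^ 4 * D 2), -(s ^ 9 * (1 + (s ^ 8) ^ 4 * D 3)),
    s ^ 81 * (1 + (s ^ 8) ^ 4 * D 4), s * (1 + (s ^ 8) ^ 4 * D 5)]

theorem linF_seriesVec {x : ℂ} (hx : x ^ 13 = 1) : ∃ b : ℂ × (Fin 6 → ℂ) → ℂ,
    Continuous b ∧ b 0 = 0 ∧ ∀ s D, linF x 1 (seriesVec s D) = s ^ 2 * x ^ 10 *
      (-1 - (x * s ^ 8) ^ 2 + (x * s ^ 8) ^ 3 + 2 * (x * s ^ 8) ^ 4 +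
        (s ^ 8) ^ 4 * b (s ^ 8, D)) := by
  let F (i : Fin 6) (p : ℂ × (Fin 6 → ℂ)) : ℂ := 1 + p.1 ^ 4 * p.2 i
  refine ⟨fun p => -(2 * p.2 5 + p.1 ^ 4 * p.2 5 ^ 2) - 2 * p.1 ^ 9 * F 2 p * F 4 p
      + (x * p.1) ^ 2 * (-(2 * p.2 3 + p.1 ^ 4 * p.2 3 ^ 2) - 2 * p.1 ^ 9 * F 0 p * F 5 p)
      + (x * p.1) ^ 3 * (p.2 2 + p.2 5 + p.1 ^ 4 * p.2 2 * p.2 5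
        + p.1 ^ 9 * (F 1 p * F 4 p - F 0 p * F 3 p))
      + (x * p.1) ^ 4 * (2 * (p.2 2 + p.2 3 + p.1 ^ 4 * p.2 2 * p.2 3) + p.1 ^ 22 * F 0 p ^ 2)
      + x ^ 6 * p.1 ^ 2 * (F 2 p ^ 2 - 2 * F 1 p * F 5 p)
      + x ^ 7 * p.1 ^ 3 * (2 * F 1 p * F 3 p - p.1 ^ 13 * F 4 p ^ 2)
      + x ^ 12 * p.1 ^ 8 * (F 1 p ^ 2 - 2 * p.1 ^ 13 * F 0 p * F 4 p), ?_, ?_, fun s D => ?_⟩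
  · fun_prop
  · simp [F]
  · let v := seriesVec s D
    have h : linF x 1 v = x ^ 13 * AA0 v + x ^ 14 * AA1 v + x ^ 17 * AA2 v + x ^ 22 * AA3 v
        + x ^ 16 * AA4 v + x ^ 12 * AA5 v + x ^ 10 * AA6 v := by
      rw [linF]
      linear_combination -(AA0 v + x * AA1 v + x ^ 4 * AA2 v + x ^ 9 * AA3 v + x ^ 3 * AA4 v) * hx
    rw [h]
    simp only [F, v, AA0, AA1, AA2, AA3, AA4, AA5, AA6, seriesVec, Matrix.cons_val]
    ring

theorem linF_seriesVec_pow {x : ℂ} (hx : x ^ 13 = 1) : ∃ r : ℂ × (Fin 6 → ℂ) → ℂ,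
    Continuous r ∧ r 0 = 0 ∧ ∀ s D, linF x 1 (seriesVec s D) ^ 10 = s ^ 20 *
      (x ^ 9 + 10 * (s ^ 8) ^ 2 * x ^ 11 - 10 * (s ^ 8) ^ 3 * x ^ 12 + 25 * (s ^ 8) ^ 4 +
        (s ^ 8) ^ 4 * r (s ^ 8, D)) := by
  obtain ⟨b, hbc, hb0, hb⟩ := linF_seriesVec hx
  let P (t : ℂ) : ℂ := -1 - t ^ 2 + t ^ 3 + 2 * t ^ 4
  have hP (t : ℂ) : P t = -1 - t ^ 2 + t ^ 3 + 2 * t ^ 4 := rfl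
  have hPc : Continuous P := by fun_prop
  let m (t : ℂ) : ℂ := 1 - t - 2 * t ^ 2
  let Q (t : ℂ) : ℂ := 45 * (-1 - 2 * t) * (2 - t - 2 * t ^ 2) + t * m t ^ 3 *
    (120 + 210 * (t ^ 2 * m t) + 252 * (t ^ 2 * m t) ^ 2 + 210 * (t ^ 2 * m t) ^ 3
      + 120 * (t ^ 2 * m t) ^ 4 + 45 * (t ^ 2 * m t) ^ 5 + 10 * (t ^ 2 * m t) ^ 6
      + (t ^ 2 * m t) ^ 7)
  have hPQ (t : ℂ) : P t ^ 10 = 1 + 10 * t ^ 2 - 10 * t ^ 3 + 25 * t ^ 4 + t ^ 5 * Q t := by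
    have h1 (y : ℂ) : (-1 - y) ^ 10 = 1 + 10 * y + 45 * y ^ 2 + y ^ 3 * (120 + 210 * y
        + 252 * y ^ 2 + 210 * y ^ 3 + 120 * y ^ 4 + 45 * y ^ 5 + 10 * y ^ 6 + y ^ 7) := by ring
    have hm : m t = 1 - t - 2 * t ^ 2 := rfl
    have h2 : P t = -1 - t ^ 2 * m t := by simp only [P, m]; ring
    have h3 : m t ^ 2 = 1 + t * ((-1 - 2 * t) * (2 - t - 2 * t ^ 2)) := by simp only [m]; ring
    rw [h2, h1]
    simp only [Q]
    linear_combination 45 * t ^ 4 * h3 + 10 * t ^ 2 * hm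
  have hQc : Continuous Q := by fun_prop
  refine ⟨fun p => x ^ 9 * (x ^ 5 * p.1 * Q (x * p.1) + b p * ∑ i ∈ Finset.range 10,
    (P (x * p.1) + p.1 ^ 4 * b p) ^ i * P (x * p.1) ^ (10 - 1 - i)), by fun_prop, ?_,
    fun s D => ?_⟩
  · simp [hb0]
  · have h := (Commute.all (P (x * s ^ 8) + (s ^ 8) ^ 4 * b (s ^ 8, D)) (P (x * s ^ 8))).geom_sum₂_mul 10
    rw [hPQ, add_sub_cancel_left] at h
    rw [hb, ← hP, mul_pow, mul_pow]
    have h100 : (x ^ 10) ^ 10 = x ^ 9 := by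
      linear_combination x ^ 9 * (x ^ 78 + x ^ 65 + x ^ 52 + x ^ 39 + x ^ 26 + x ^ 13 + 1) * hx
    rw [h100]
    linear_combination (-s ^ 20 * x ^ 9) * h + 25 * s ^ 52 * hx

theorem Phi20_seriesVec : ∃ r : ℂ × (Fin 6 → ℂ) → ℂ, Continuous r ∧ r 0 = 0 ∧
    ∀ s D, Phi20 (seriesVec s D) = s ^ 52 * (1 + r (s ^ 8, D)) := by
  have hζ (ν : ℕ) : (ζ ^ ν) ^ 13 = 1 := by
    rw [pow_right_comm, ζ_isPrimitiveRoot.pow_eq_one, one_pow]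
  choose r hc h0 hr using fun ν => linF_seriesVec_pow (hζ ν)
  refine ⟨fun p => 1 / 325 * (∑ ν ∈ Finset.range 13, r ν p + 13 ^ 5 * p.1 ^ 26 *
    ((1 + p.1 ^ 4 * p.2 2) * (1 + p.1 ^ 4 * p.2 5) + p.1 ^ 13 * ((1 + p.1 ^ 4 * p.2 1) *
      (1 + p.1 ^ 4 * p.2 4) - (1 + p.1 ^ 4 * p.2 0) * (1 + p.1 ^ 4 * p.2 3))) ^ 10),
    by fun_prop, by simp [h0], fun s D => ?_⟩
  have hsum {m : ℕ} (hm : m.Coprime 13) : ∑ ν ∈ Finset.range 13, (ζ ^ ν) ^ m = 0 := by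
    simp_rw [pow_right_comm]
    exact (ζ_isPrimitiveRoot.pow_of_coprime m hm).geom_sum_eq_zero (by norm_num)
  have hlin (ν : ℕ) : linF ζ ν (seriesVec s D) = linF (ζ ^ ν) 1 (seriesVec s D) := by
    simp only [linF, ← pow_mul, mul_one, one_mul, mul_comm ν]
  have h0' : AA0 (seriesVec s D) = s ^ 26 * ((1 + (s ^ 8) ^ 4 * D 2) * (1 + (s ^ 8) ^ 4 * D 5) +
      (s ^ 8) ^ 13 * ((1 + (s ^ 8) ^ 4 * D 1) * (1 + (s ^ 8) ^ 4 * D 4)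
        - (1 + (s ^ 8) ^ 4 * D 0) * (1 + (s ^ 8) ^ 4 * D 3))) := by
    simp only [AA0, seriesVec, Matrix.cons_val]
    ring
  simp only [Phi20_eq_linF, hlin, hr, h0', ← Finset.mul_sum, Finset.sum_add_distrib,
    Finset.sum_sub_distrib, hsum (show Nat.Coprime 9 13 by norm_num),
    hsum (show Nat.Coprime 11 13 by norm_num), hsum (show Nat.Coprime 12 13 by norm_num),
    Finset.sum_const, Finset.card_range, mul_pow]
  generalize ∑ ν ∈ Finset.range 13, r ν (s ^ 8, D) = R
  generalize ((1 + (s ^ 8) ^ 4 * D 2) * (1 + (s ^ 8) ^ 4 * D 5) +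
      (s ^ 8) ^ 13 * ((1 + (s ^ 8) ^ 4 * D 1) * (1 + (s ^ 8) ^ 4 * D 4)
        - (1 + (s ^ 8) ^ 4 * D 0) * (1 + (s ^ 8) ^ 4 * D 3))) = a
  ring

open UpperHalfPlane in
theorem tendsto_Phi20_AV :
    Filter.Tendsto (fun z : ℍ => Phi20 (AV z) / cexp (2 * Real.pi * Complex.I * z / 104) ^ 52)
      atImInfty (nhds 1) := by
  have hu : Filter.Tendsto (fun z : ℍ => cexp (2 * Real.pi * Complex.I * z / 13)) atImInfty (nhds 0) := by
    have := UpperHalfPlane.qParam_tendsto_atImInfty (h := 13) (by norm_num)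
    simpa [Function.Periodic.qParam, Function.comp_def] using this
  let κ : Fin 6 → ℤ := ![11, 7, 5, 3, 9, 1]
  have hκ (i : Fin 6) : |κ i| ≤ 11 := by fin_cases i <;> decide
  let D (z : ℍ) (i : Fin 6) : ℂ := thetaTail (κ i) (cexp (2 * Real.pi * Complex.I * z / 13))
  have hD : Filter.Tendsto D atImInfty (nhds 0) :=
    tendsto_pi_nhds.2 fun i => (tendsto_thetaTail (hκ i)).comp hu
  obtain ⟨r, hrc, hr0, hr⟩ := Phi20_seriesVec
  have hlim : Filter.Tendsto (fun z : ℍ => 1 + r (cexp (2 * Real.pi * Complex.I * z / 13), D z))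
      atImInfty (nhds 1) := by
    have h := (hrc.tendsto 0).comp (hu.prodMk_nhds hD)
    rw [hr0] at h
    simpa using h.const_add 1
  refine hlim.congr' ?_
  filter_upwards [hu (Metric.closedBall_mem_nhds (0 : ℂ) (by norm_num : (0 : ℝ) < 1 / 2))] with z hz
  have hz' := mem_closedBall_zero_iff.1 hz
  have h8 : cexp (2 * Real.pi * Complex.I * z / 104) ^ 8 = cexp (2 * Real.pi * Complex.I * z / 13) := by
    rw [← Complex.exp_nat_mul]
    congr 1
    push_cast
    ring
  have hAV : AV z = seriesVec (cexp (2 * Real.pi * Complex.I * z / 104)) (D z) := by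
    have h11 := th13_sq_eq_thetaTail (k := 11) (by decide) (by decide) hz'
    have h7 := th13_sq_eq_thetaTail (k := 7) (by decide) (by decide) hz'
    have h5 := th13_sq_eq_thetaTail (k := 5) (by decide) (by decide) hz'
    have h3 := th13_sq_eq_thetaTail (k := 3) (by decide) (by decide) hz'
    have h9 := th13_sq_eq_thetaTail (k := 9) (by decide) (by decide) hz'
    have h1 := th13_sq_eq_thetaTail (k := 1) (by decide) (by decide) hz'
    norm_num at h11 h7 h5 h3 h9 h1
    rw [one_div] at h1
    ext i
    fin_cases i <;> simp [AV, ta, seriesVec, D, κ, *]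
  rw [hAV, hr, h8, mul_div_cancel_left₀ _ (pow_ne_zero _ (Complex.exp_ne_zero _))]

open UpperHalfPlane in
theorem tendsto_etaF_pow :
    Filter.Tendsto (fun z : ℍ => etaF z ^ 12 / cexp (2 * Real.pi * Complex.I * z / 104) ^ 52)
      atImInfty (nhds 1) := by
  have h := (tendsto_tprod_one_add_of_dominated_convergence (𝓕 := nhds 0) (g := 0)
      (f := fun (q : ℂ) (n : ℕ) ↦ -q ^ (n + 1)) (bound := fun n ↦ (1 / 2 : ℝ) ^ (n + 1))
      (by simpa only [pow_succ'] using summable_geometric_two.mul_left _)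
      (fun k ↦ by simpa using ((continuous_pow (M := ℂ) (k + 1)).tendsto 0).neg) (by
        filter_upwards [Metric.ball_mem_nhds (0 : ℂ) (by norm_num : (0 : ℝ) < 1 / 2)] with q hq k
        rw [norm_neg, norm_pow]
        exact pow_le_pow_left₀ (norm_nonneg _) (mem_ball_zero_iff.mp hq).le _))
  have h2 := (h.comp (UpperHalfPlane.qParam_tendsto_atImInfty zero_lt_one)).pow 12
  simp only [Pi.zero_apply, add_zero, tprod_one, one_pow] at h2
  refine h2.congr fun z => ?_
  have hs : cexp (2 * Real.pi * Complex.I * z / 104) ^ 52 = cexp (2 * Real.pi * Complex.I * z / 24) ^ 12 := by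
    rw [← Complex.exp_nat_mul, ← Complex.exp_nat_mul]
    congr 1
    push_cast
    ring
  rw [etaF, mul_pow, hs, mul_div_cancel_left₀ _ (pow_ne_zero _ (Complex.exp_ne_zero _))]
  simp [Function.Periodic.qParam, sub_eq_add_neg]

open UpperHalfPlane in
theorem tendsto_Phi20_AV_div_etaF :
    Filter.Tendsto (fun z : ℍ => Phi20 (AV z) / etaF z ^ 12) atImInfty (nhds 1) := by
  have h := tendsto_Phi20_AV.div tendsto_etaF_pow one_ne_zero
  rw [div_one] at h
  refine h.congr fun z => ?_
  exact div_div_div_cancel_right₀ (pow_ne_zero _ (Complex.exp_ne_zero _)) _ _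

section ModularForm

open UpperHalfPlane ModularForm SlashInvariantForm
open scoped MatrixGroups

/-- The quotient `Φ₂₀(a) / η ^ 12` as a function on the upper half-plane. -/
def thetaQuotient (z : ℍ) : ℂ := Phi20 (AV z) / etaF z ^ 12

theorem thetaQuotient_slash_S : thetaQuotient ∣[(4 : ℤ)] ModularGroup.S = thetaQuotient := by
  ext z
  have hz := z.ne_zero
  have hη := pow_ne_zero 12 (etaF_ne_zero z.im_pos)
  rw [SL_slash_apply, UpperHalfPlane.modular_S_smul, ModularGroup.denom_S]
  have hinv : (-z : ℂ)⁻¹ = -1 / z := by rw [inv_neg, neg_div, one_div]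
  simp only [thetaQuotient, hinv, Phi20_AV_neg_inv z.im_pos,
    etaF_neg_inv_pow z.im_pos]
  field_simp

theorem thetaQuotient_slash_T : thetaQuotient ∣[(4 : ℤ)] ModularGroup.T = thetaQuotient := by
  ext z
  have hT : denom ModularGroup.T z = 1 := by
    rw [ModularGroup.denom_apply]
    simp [ModularGroup.T]
  rw [SL_slash_apply, modular_T_smul, hT]
  simp [thetaQuotient, add_comm (1 : ℂ), Phi20_AV_add_one, etaF_add_one_pow, neg_div_neg_eq]

/-- The quotient `Φ₂₀(a) / η ^ 12` as a modular form of weight four and level one. -/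
def thetaQuotientMF : ModularForm 𝒮ℒ 4 where
  toFun := thetaQuotient
  slash_action_eq' A hA := by
    obtain ⟨A, rfl⟩ := hA
    exact slash_action_generators_SL2Z thetaQuotient_slash_S thetaQuotient_slash_T A
  holo' := by
    rw [UpperHalfPlane.mdifferentiable_iff]
    refine .congr (fun z hz ↦ ((differentiableAt_Phi20_AV hz).div
      ((differentiableAt_etaF hz).pow 12)
      (pow_ne_zero _ (etaF_ne_zero hz))).differentiableWithinAt) fun z hz ↦ ?_
    simp [thetaQuotient, ofComplex_apply_of_im_pos hz]
  bdd_at_cusps' hc := by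
    rw [Subgroup.IsArithmetic.isCusp_iff_isCusp_SL2Z] at hc
    rw [OnePoint.isBoundedAt_iff_forall_SL2Z hc]
    intro γ _
    rw [slash_action_generators_SL2Z thetaQuotient_slash_S thetaQuotient_slash_T]
    exact tendsto_Phi20_AV_div_etaF.isBigO_one ℝ

theorem thetaQuotientMF_eq_E₄ : thetaQuotientMF = E₄ := by
  have hcoeff : (qExpansion 1 thetaQuotientMF).coeff 0 = 1 := by
    rw [UpperHalfPlane.qExpansion_coeff_zero one_pos
      (ModularFormClass.analyticAt_cuspFunction_zero thetaQuotientMF one_pos one_mem_strictPeriods_SL)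
      (SlashInvariantFormClass.periodic_comp_ofComplex thetaQuotientMF one_mem_strictPeriods_SL)]
    exact tendsto_Phi20_AV_div_etaF.limUnder_eq
  refine sub_eq_zero.1 (sturm_bound_levelOne ?_)
  rw [FunLike.coe_sub, ModularForm.qExpansion_sub one_pos one_mem_strictPeriods_SL]
  refine lt_of_lt_of_le (b := ((1 : ℕ) : ℕ∞)) (by norm_num) (PowerSeries.nat_le_order _ _ ?_)
  intro i hi
  obtain rfl : i = 0 := by lia
  rw [map_sub, hcoeff, EisensteinSeries.E_qExpansion_coeff_zero _ ⟨2, rfl⟩, sub_self]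

theorem E₄_apply (z : ℍ) : E₄ z = Eis 4 z := by
  let e : EisensteinSeries.gammaSet 1 1 0 ≃ {p : ℤ × ℤ // Int.gcd p.1 p.2 = 1} :=
    (finTwoArrowEquiv ℤ).subtypeEquiv fun v => by
      rw [EisensteinSeries.gammaSet_one_mem_iff]
      rfl
  have h : E₄ z = (1 / 2 : ℂ) * ∑' v : EisensteinSeries.gammaSet 1 1 0,
      EisensteinSeries.eisSummand 4 v z := rfl
  rw [h, Eis, ← e.tsum_eq]
  congr 2
  ext v
  simp [e, EisensteinSeries.eisSummand, zpow_neg]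

end ModularForm

theorem xV_eq_smul (z : ℂ) : xV z = etaF z • AV z := rfl

theorem stmt12 (z : ℂ) (hz : 0 < z.im) :
    Phi20 (xV z) = (etaF z) ^ 8 * Δfun z * Eis 4 z := by
  have h : thetaQuotientMF ⟨z, hz⟩ = Eis 4 z := by
    rw [thetaQuotientMF_eq_E₄]
    exact E₄_apply ⟨z, hz⟩
  have h2 : Phi20 (AV z) / etaF z ^ 12 = Eis 4 z := h
  rw [div_eq_iff (pow_ne_zero _ (etaF_ne_zero hz))] at h2
  rw [xV_eq_smul, Phi20_smul, h2, Δfun]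
  ring
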